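/- arXiv:2301.05682 — 11 statements merged into one kernel-verified Lean document; each statement's English description precedes it below -/
import Mathlib

section
/- Let v : {0, 1, …, n+1} → [0,1] be monotone nondecreasing with v(0) = 0 and v(n+1) = 1. For i ∈ {1,…,n} define ℓ(i) = max{ v(q_j) : 0 ≤ j ≤ k+1, q_j ≤ i }, u(i) = min{ v(q_j) : 0 ≤ j ≤ k+1, q_j ≥ i }, and d(i) = u(i) − ℓ(i). Then ∑_{i=1}^n a_i · d(i) ≤ 1/(k+1). In particular, if ε > 0 and k + 1 ≥ 1/(2ε), then ∑_{i=1}^n a_i · d(i) ≤ 2ε. -/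
/-- Context: `a` is a probability vector on `{1,…,n}`, and the query points are
`q j = min { x ∈ {1,…,n} : ∑_{i=1}^x a i ≥ j/(k+1) }` for `j ∈ {1,…,k}`,
with `q 0 = 0` and `q (k+1) = n+1`.
Statement: for a monotone `v : {0,…,n+1} → [0,1]` with `v 0 = 0` and `v (n+1) = 1`,
setting `ℓ i = max { v (q j) : q j ≤ i }`, `u i = min { v (q j) : q j ≥ i }` and
`d i = u i − ℓ i`, one has `∑_{i=1}^n a i * d i ≤ 1/(k+1)`; in particular if
`ε > 0` and `k + 1 ≥ 1/(2ε)` then `∑_{i=1}^n a i * d i ≤ 2ε`. -/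
theorem query_payoff_le (n k : ℕ) (hn : 0 < n) (hk : 0 < k)
    (a : ℕ → ℝ)
    (ha0 : ∀ i ∈ Finset.Icc 1 n, 0 ≤ a i)
    (ha1 : ∑ i ∈ Finset.Icc 1 n, a i = 1)
    (q : ℕ → ℕ)
    (hq0 : q 0 = 0)
    (hqtop : q (k + 1) = n + 1)
    (hq : ∀ j ∈ Finset.Icc 1 k,
      q j = sInf {x | x ∈ Finset.Icc 1 n ∧
        (j : ℝ) / ((k : ℝ) + 1) ≤ ∑ i ∈ Finset.Icc 1 x, a i})
    (v : ℕ → ℝ)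
    (hv01 : ∀ i ≤ n + 1, v i ∈ Set.Icc (0 : ℝ) 1)
    (hvmono : ∀ i j : ℕ, i ≤ j → j ≤ n + 1 → v i ≤ v j)
    (hv0 : v 0 = 0)
    (hvtop : v (n + 1) = 1)
    (ℓ u : ℕ → ℝ)
    (hℓ : ∀ i ∈ Finset.Icc 1 n,
      ℓ i = sSup {y | ∃ j ≤ k + 1, q j ≤ i ∧ y = v (q j)})
    (hu : ∀ i ∈ Finset.Icc 1 n,
      u i = sInf {y | ∃ j ≤ k + 1, i ≤ q j ∧ y = v (q j)}) :
    (∑ i ∈ Finset.Icc 1 n, a i * (u i - ℓ i) ≤ 1 / ((k : ℝ) + 1)) ∧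
    (∀ ε : ℝ, 0 < ε → 1 / (2 * ε) ≤ (k : ℝ) + 1 →
      ∑ i ∈ Finset.Icc 1 n, a i * (u i - ℓ i) ≤ 2 * ε) := by
  have hk1 : (0 : ℝ) < (k : ℝ) + 1 := by positivity
  have hmem : ∀ j, 1 ≤ j → j ≤ k → q j ∈ {x | x ∈ Finset.Icc 1 n ∧
        (j : ℝ) / ((k : ℝ) + 1) ≤ ∑ i ∈ Finset.Icc 1 x, a i} := by
    intro j h1 h2
    rw [hq j (Finset.mem_Icc.2 ⟨h1, h2⟩)]
    apply Nat.sInf_mem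
    refine ⟨n, Finset.mem_Icc.2 ⟨hn, le_rfl⟩, ?_⟩
    rw [ha1, div_le_one hk1]
    have : (j : ℝ) ≤ k := by exact_mod_cast h2
    linarith
  have hqn : ∀ j ≤ k, q j ≤ n := by
    intro j hj
    rcases Nat.eq_zero_or_pos j with rfl | h
    · omega
    · exact (Finset.mem_Icc.1 (hmem j h hj).1).2
  have hqn' : ∀ j ≤ k + 1, q j ≤ n + 1 := by
    intro j hj
    rcases Nat.lt_or_ge k j with h | h
    · have : j = k + 1 := by omega
      subst this; omega
    · have := hqn j h; omega
  have hlow : ∀ j ≤ k, (j : ℝ) / ((k : ℝ) + 1) ≤ ∑ i ∈ Finset.Icc 1 (q j), a i := by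
    intro j hj
    rcases Nat.eq_zero_or_pos j with rfl | h
    · simp [hq0]
    · exact (hmem j h hj).2
  have hup : ∀ j ≤ k, ∀ x < q (j + 1),
      ∑ i ∈ Finset.Icc 1 x, a i ≤ ((j : ℝ) + 1) / ((k : ℝ) + 1) := by
    intro j hj x hx
    have hxn : x ≤ n := by have := hqn' (j + 1) (by omega); omega
    rcases Nat.eq_zero_or_pos x with rfl | h0
    · simp; positivity
    rcases Nat.lt_or_ge j k with h | h
    · rw [hq (j + 1) (Finset.mem_Icc.2 ⟨by omega, by omega⟩)] at hx
      have := Nat.notMem_of_lt_sInf hx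
      by_contra hc
      refine this ⟨Finset.mem_Icc.2 ⟨h0, hxn⟩, ?_⟩
      push_cast
      linarith
    · have : j = k := by omega
      subst this
      rw [div_self hk1.ne', ← ha1]
      apply Finset.sum_le_sum_of_subset_of_nonneg
      · exact Finset.Icc_subset_Icc_right hxn
      · intro i hi _; exact ha0 i hi
  have hqmono : ∀ j ≤ k, q j ≤ q (j + 1) := by
    intro j hj
    rcases Nat.eq_zero_or_pos j with rfl | h0
    · omega
    rcases Nat.lt_or_ge j k with h | h
    · rw [hq j (Finset.mem_Icc.2 ⟨h0, hj⟩)]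
      have hm := hmem (j + 1) (by omega) (by omega)
      refine Nat.sInf_le ⟨hm.1, le_trans ?_ hm.2⟩
      gcongr
      simp
    · have : j = k := by omega
      subst this
      have := hqn j le_rfl; omega
  have hΔ : ∀ j ≤ k, 0 ≤ v (q (j + 1)) - v (q j) := by
    intro j hj
    have := hvmono _ _ (hqmono j hj) (hqn' (j + 1) (by omega))
    linarith
  have hmass : ∀ j ≤ k, ∑ i ∈ (Finset.Icc 1 n).filter (fun i => q j < i ∧ i < q (j + 1)), a i
      ≤ 1 / ((k : ℝ) + 1) := by
    intro j hj
    rcases Nat.lt_or_ge (q j) (q (j + 1)) with h | h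
    · have h1 := hup j hj (q (j + 1) - 1) (by omega)
      have h2 := hlow j hj
      have h4 := hqn' (j + 1) (by omega)
      have h3 : Finset.Icc 1 (q (j + 1) - 1) = Finset.Icc 1 (q j) ∪
          (Finset.Icc 1 n).filter (fun i => q j < i ∧ i < q (j + 1)) := by
        ext i; simp only [Finset.mem_Icc, Finset.mem_union, Finset.mem_filter]; omega
      rw [h3, Finset.sum_union] at h1
      · rw [add_div] at h1; linarith
      · rw [Finset.disjoint_left]
        intro i; simp only [Finset.mem_Icc, Finset.mem_filter]; omega
    · rw [Finset.filter_false_of_mem]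
      · simp; positivity
      · intro i _; omega
  have hu' : ∀ i ∈ Finset.Icc 1 n, ∀ j ≤ k + 1, i ≤ q j → u i ≤ v (q j) := by
    intro i hi j hj hij
    rw [hu i hi]
    refine csInf_le ⟨0, ?_⟩ ⟨j, hj, hij, rfl⟩
    rintro y ⟨j', hj', _, rfl⟩
    exact (hv01 _ (hqn' j' hj')).1
  have hl' : ∀ i ∈ Finset.Icc 1 n, ∀ j ≤ k + 1, q j ≤ i → v (q j) ≤ ℓ i := by
    intro i hi j hj hij
    rw [hℓ i hi]
    refine le_csSup ⟨1, ?_⟩ ⟨j, hj, hij, rfl⟩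
    rintro y ⟨j', hj', _, rfl⟩
    exact (hv01 _ (hqn' j' hj')).2
  have hd : ∀ i ∈ Finset.Icc 1 n, u i - ℓ i ≤ ∑ j ∈ Finset.range (k + 1),
      (if q j < i ∧ i < q (j + 1) then v (q (j + 1)) - v (q j) else 0) := by
    intro i hi
    have hi' := Finset.mem_Icc.1 hi
    have hnn : ∀ j ∈ Finset.range (k + 1),
        0 ≤ (if q j < i ∧ i < q (j + 1) then v (q (j + 1)) - v (q j) else 0) := by
      intro j hj
      have := hΔ j (by simp at hj; omega)
      split_ifs <;> simp_all
    obtain ⟨j, hjk, hj1, hj2⟩ : ∃ j ≤ k, q j ≤ i ∧ i < q (j + 1) := by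
      by_contra hc
      push Not at hc
      have : ∀ j ≤ k + 1, q j ≤ i := by
        intro j
        induction j with
        | zero => intro _; omega
        | succ m ih => intro hm; exact hc m (by omega) (ih (by omega))
      have := this (k + 1) le_rfl
      omega
    have hL := hl' i hi j (by omega) hj1
    rcases Nat.lt_or_ge (q j) i with h | h
    · refine le_trans ?_ (Finset.single_le_sum hnn (Finset.mem_range.2 (show j < k + 1 by omega)))
      rw [if_pos ⟨h, hj2⟩]
      have := hu' i hi (j + 1) (by omega) hj2.le
      linarith
    · have := hu' i hi j (by omega) h
      refine le_trans ?_ (Finset.sum_nonneg hnn)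
      linarith
  have main : ∑ i ∈ Finset.Icc 1 n, a i * (u i - ℓ i) ≤ 1 / ((k : ℝ) + 1) := by
    calc ∑ i ∈ Finset.Icc 1 n, a i * (u i - ℓ i)
        ≤ ∑ i ∈ Finset.Icc 1 n, a i * ∑ j ∈ Finset.range (k + 1),
          (if q j < i ∧ i < q (j + 1) then v (q (j + 1)) - v (q j) else 0) :=
          Finset.sum_le_sum fun i hi => mul_le_mul_of_nonneg_left (hd i hi) (ha0 i hi)
      _ = ∑ j ∈ Finset.range (k + 1), (v (q (j + 1)) - v (q j)) *
          ∑ i ∈ (Finset.Icc 1 n).filter (fun i => q j < i ∧ i < q (j + 1)), a i := by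
          simp_rw [Finset.mul_sum]
          rw [Finset.sum_comm]
          refine Finset.sum_congr rfl fun j _ => ?_
          rw [Finset.sum_filter]
          refine Finset.sum_congr rfl fun i _ => ?_
          split_ifs <;> ring
      _ ≤ ∑ j ∈ Finset.range (k + 1), (v (q (j + 1)) - v (q j)) * (1 / ((k : ℝ) + 1)) := by
          refine Finset.sum_le_sum fun j hj => ?_
          have hj' : j ≤ k := by simp at hj; omega
          exact mul_le_mul_of_nonneg_left (hmass j hj') (hΔ j hj')
      _ = 1 / ((k : ℝ) + 1) := by
          rw [← Finset.sum_mul, Finset.sum_range_sub (fun j => v (q j))]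
          simp [hqtop, hq0, hvtop, hv0]
  refine ⟨main, fun ε hε h => main.trans ?_⟩
  rw [div_le_iff₀ (by positivity)] at h
  rw [div_le_iff₀ hk1]
  linarith
end

section
/- One has ∑_{t=1}^T ∑_{i=1}^n a_{i,t} · d_t(i) ≥ (1 − η) · max_{i ∈ {1,…,n}} ( ∑_{t=1}^T d_t(i) ) − ln(n)/η. -/
/-- Context: Hedge weights `w i 0 = 1/n`, `a i t = w i (t-1) / ∑ i' w i' (t-1)`,
`w i t = w i (t-1) * (1+η)^(d t i)`, with gains `d t i ∈ [0,1]`.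
Statement: `∑_{t=1}^T ∑_{i=1}^n a i t * d t i ≥
(1 − η) * max_{i ∈ {1,…,n}} (∑_{t=1}^T d t i) − ln n / η`. -/
theorem hedge_regret (n T : ℕ) (hn : 2 ≤ n) (hT : 1 ≤ T)
    (η : ℝ) (hη0 : 0 < η) (hη1 : η ≤ 1)
    (d : ℕ → ℕ → ℝ)
    (hd : ∀ t ∈ Finset.Icc 1 T, ∀ i ∈ Finset.Icc 1 n, d t i ∈ Set.Icc (0 : ℝ) 1)
    (w : ℕ → ℕ → ℝ) (a : ℕ → ℕ → ℝ)
    (hw0 : ∀ i ∈ Finset.Icc 1 n, w i 0 = 1 / (n : ℝ))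
    (ha : ∀ t ∈ Finset.Icc 1 T, ∀ i ∈ Finset.Icc 1 n,
      a i t = w i (t - 1) / ∑ i' ∈ Finset.Icc 1 n, w i' (t - 1))
    (hw : ∀ t ∈ Finset.Icc 1 T, ∀ i ∈ Finset.Icc 1 n,
      w i t = w i (t - 1) * (1 + η) ^ (d t i)) :
    ∑ t ∈ Finset.Icc 1 T, ∑ i ∈ Finset.Icc 1 n, a i t * d t i ≥
      (1 - η) * (Finset.Icc 1 n).sup'
          (Finset.nonempty_Icc.mpr (by omega)) (fun i => ∑ t ∈ Finset.Icc 1 T, d t i)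
        - Real.log n / η := by
  have hn0 : (0 : ℝ) < n := by
    have : 0 < n := by omega
    exact_mod_cast this
  have h1 : (0 : ℝ) < 1 + η := by linarith
  have hne : (Finset.Icc 1 n).Nonempty := Finset.nonempty_Icc.mpr (by omega)
  have hwk : ∀ k, k ≤ T → ∀ i ∈ Finset.Icc 1 n,
      w i k = 1 / (n : ℝ) * (1 + η) ^ (∑ t ∈ Finset.Icc 1 k, d t i) := by
    intro k
    induction k with
    | zero =>
      intro _ i hi
      simpa using hw0 i hi
    | succ k ih =>
      intro hk i hi
      rw [hw (k + 1) (Finset.mem_Icc.mpr ⟨by omega, hk⟩) i hi, Nat.add_sub_cancel,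
        ih (by omega) i hi, Finset.sum_Icc_succ_top (by omega), Real.rpow_add h1]
      ring
  have hpos : ∀ k, k ≤ T → ∀ i ∈ Finset.Icc 1 n, 0 < w i k := by
    intro k hk i hi
    rw [hwk k hk i hi]
    positivity
  have hW : ∀ k, k ≤ T → ∑ i ∈ Finset.Icc 1 n, w i k ≤
      Real.exp (η * ∑ t ∈ Finset.Icc 1 k, ∑ i ∈ Finset.Icc 1 n, a i t * d t i) := by
    intro k
    induction k with
    | zero =>
      intro _
      rw [Finset.sum_congr rfl hw0]
      simp [hn0.ne']
    | succ k ih =>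
      intro hk
      have hmem : k + 1 ∈ Finset.Icc 1 T := Finset.mem_Icc.mpr ⟨by omega, hk⟩
      have hS : 0 < ∑ i ∈ Finset.Icc 1 n, w i k :=
        Finset.sum_pos (hpos k (by omega)) hne
      have hg : (∑ i ∈ Finset.Icc 1 n, w i k) *
          (∑ i ∈ Finset.Icc 1 n, a i (k + 1) * d (k + 1) i) =
          ∑ i ∈ Finset.Icc 1 n, w i k * d (k + 1) i := by
        rw [Finset.mul_sum]
        refine Finset.sum_congr rfl fun i hi => ?_
        rw [ha (k + 1) hmem i hi, Nat.add_sub_cancel]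
        field_simp
      rw [Finset.sum_Icc_succ_top (by omega), mul_add, Real.exp_add]
      calc ∑ i ∈ Finset.Icc 1 n, w i (k + 1)
          ≤ ∑ i ∈ Finset.Icc 1 n, (w i k + η * (w i k * d (k + 1) i)) := by
            refine Finset.sum_le_sum fun i hi => ?_
            rw [hw (k + 1) hmem i hi, Nat.add_sub_cancel]
            have hb := rpow_one_add_le_one_add_mul_self (s := η) (by linarith)
              (hd (k + 1) hmem i hi).1 (hd (k + 1) hmem i hi).2
            have := mul_le_mul_of_nonneg_left hb (hpos k (by omega) i hi).le
            linarith
        _ = (∑ i ∈ Finset.Icc 1 n, w i k) *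
            (η * (∑ i ∈ Finset.Icc 1 n, a i (k + 1) * d (k + 1) i) + 1) := by
            rw [Finset.sum_add_distrib, ← Finset.mul_sum, ← hg]
            ring
        _ ≤ (∑ i ∈ Finset.Icc 1 n, w i k) *
            Real.exp (η * (∑ i ∈ Finset.Icc 1 n, a i (k + 1) * d (k + 1) i)) :=
            mul_le_mul_of_nonneg_left (Real.add_one_le_exp _) hS.le
        _ ≤ _ := mul_le_mul_of_nonneg_right (ih (by omega)) (Real.exp_pos _).le
  obtain ⟨i, hi, hsup⟩ := Finset.exists_mem_eq_sup' hne
    (fun i => ∑ t ∈ Finset.Icc 1 T, d t i)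
  rw [hsup]
  have hD : 0 ≤ ∑ t ∈ Finset.Icc 1 T, d t i :=
    Finset.sum_nonneg fun t ht => (hd t ht i hi).1
  have hle := (Finset.single_le_sum (f := fun i => w i T)
    (fun j hj => (hpos T le_rfl j hj).le) hi).trans (hW T le_rfl)
  have hlog := Real.log_le_log (hpos T le_rfl i hi) hle
  rw [Real.log_exp, hwk T le_rfl i hi, Real.log_mul (by positivity) (by positivity),
    Real.log_rpow h1, one_div, Real.log_inv] at hlog
  have hl : η * (1 - η) ≤ Real.log (1 + η) := by
    refine le_trans ?_ (Real.one_sub_inv_le_log_of_pos h1)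
    have : 1 - (1 + η)⁻¹ = η / (1 + η) := by field_simp; ring
    rw [this, le_div_iff₀ h1]
    nlinarith [pow_pos hη0 3]
  have hm := mul_le_mul_of_nonneg_left hl hD
  have hfin : η * ((1 - η) * (∑ t ∈ Finset.Icc 1 T, d t i) - Real.log n / η) ≤
      η * ∑ t ∈ Finset.Icc 1 T, ∑ i ∈ Finset.Icc 1 n, a i t * d t i := by
    rw [mul_sub, mul_div_cancel₀ _ hη0.ne']
    linarith
  exact le_of_mul_le_mul_left hfin hη0
end

section
/- With η = 1/3, suppose in addition that k is a positive integer and ε ∈ (0,1) a real number satisfying k + 1 ≥ 1/ε, that T ≥ 9 ln(n)/ε, and that ∑_{i=1}^n a_{i,t} · d_t(i) ≤ 1/(k+1) for every t ∈ {1,…,T}. Then max_{i ∈ {1,…,n}} (1/T) ∑_{t=1}^T d_t(i) ≤ 2ε. -/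
/-- Context: Hedge weights `w i 0 = 1/n`, `a i t = w i (t-1) / ∑ i' w i' (t-1)`,
`w i t = w i (t-1) * (1+η)^(d t i)`, with gains `d t i ∈ [0,1]` and `η = 1/3`.
Statement: if `k + 1 ≥ 1/ε`, `T ≥ 9 ln n / ε`, and
`∑_{i=1}^n a i t * d t i ≤ 1/(k+1)` for every `t ∈ {1,…,T}`, then
`max_{i ∈ {1,…,n}} (1/T) ∑_{t=1}^T d t i ≤ 2ε`. -/
theorem hedge_cdf_bound (n T : ℕ) (hn : 2 ≤ n) (hT : 1 ≤ T)
    (η : ℝ) (hη : η = 1 / 3)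
    (k : ℕ) (hk : 0 < k)
    (ε : ℝ) (hε0 : 0 < ε) (hε1 : ε < 1)
    (hkε : 1 / ε ≤ (k : ℝ) + 1)
    (hTε : 9 * Real.log n / ε ≤ (T : ℝ))
    (d : ℕ → ℕ → ℝ)
    (hd : ∀ t ∈ Finset.Icc 1 T, ∀ i ∈ Finset.Icc 1 n, d t i ∈ Set.Icc (0 : ℝ) 1)
    (w : ℕ → ℕ → ℝ) (a : ℕ → ℕ → ℝ)
    (hw0 : ∀ i ∈ Finset.Icc 1 n, w i 0 = 1 / (n : ℝ))
    (ha : ∀ t ∈ Finset.Icc 1 T, ∀ i ∈ Finset.Icc 1 n,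
      a i t = w i (t - 1) / ∑ i' ∈ Finset.Icc 1 n, w i' (t - 1))
    (hw : ∀ t ∈ Finset.Icc 1 T, ∀ i ∈ Finset.Icc 1 n,
      w i t = w i (t - 1) * (1 + η) ^ (d t i))
    (hsum : ∀ t ∈ Finset.Icc 1 T,
      ∑ i ∈ Finset.Icc 1 n, a i t * d t i ≤ 1 / ((k : ℝ) + 1)) :
    (Finset.Icc 1 n).sup' (Finset.nonempty_Icc.mpr (by omega))
        (fun i => (1 / (T : ℝ)) * ∑ t ∈ Finset.Icc 1 T, d t i) ≤ 2 * ε := by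
  subst hη
  have hn0 : (0 : ℝ) < n := by exact_mod_cast (by omega : 0 < n)
  have hT0 : (0 : ℝ) < T := by exact_mod_cast (by omega : 0 < T)
  have hne : (Finset.Icc 1 n).Nonempty := Finset.nonempty_Icc.mpr (by omega)
  have hkε' : 1 / ((k : ℝ) + 1) ≤ ε := by
    have h := one_div_le_one_div_of_le (by positivity) hkε
    simpa using h
  have hclosed : ∀ s : ℕ, s ≤ T → ∀ i ∈ Finset.Icc 1 n,
      w i s = 1 / (n : ℝ) * (1 + 1 / 3 : ℝ) ^ (∑ t ∈ Finset.Icc 1 s, d t i) := by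
    intro s
    induction s with
    | zero => intro _ i hi; simp [hw0 i hi]
    | succ s ih =>
      intro hs i hi
      have h := hw (s + 1) (Finset.mem_Icc.mpr ⟨by omega, hs⟩) i hi
      rw [h, Nat.add_sub_cancel, ih (by omega) i hi,
        Finset.sum_Icc_succ_top (by omega : 1 ≤ s + 1),
        Real.rpow_add (by norm_num), mul_assoc]
  have hpos : ∀ s : ℕ, s ≤ T → ∀ i ∈ Finset.Icc 1 n, 0 < w i s := by
    intro s hs i hi
    rw [hclosed s hs i hi]
    positivity
  have hW : ∀ s : ℕ, s ≤ T → ∑ i ∈ Finset.Icc 1 n, w i s ≤ Real.exp (ε / 3 * s) := by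
    intro s
    induction s with
    | zero =>
      intro _
      rw [Finset.sum_congr rfl hw0]
      simp [hn0.ne']
    | succ s ih =>
      intro hs
      have hm : s + 1 ∈ Finset.Icc 1 T := Finset.mem_Icc.mpr ⟨by omega, hs⟩
      have ih' := ih (by omega)
      have hWpos : 0 < ∑ i ∈ Finset.Icc 1 n, w i s :=
        Finset.sum_pos (hpos s (by omega)) hne
      have h1 : ∑ i ∈ Finset.Icc 1 n, w i s * d (s + 1) i
          ≤ ε * ∑ i ∈ Finset.Icc 1 n, w i s := by
        have h := (hsum (s + 1) hm).trans hkε'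
        rw [← div_le_iff₀ hWpos, Finset.sum_div]
        refine le_trans (le_of_eq ?_) h
        refine Finset.sum_congr rfl fun i hi => ?_
        rw [ha (s + 1) hm i hi, Nat.add_sub_cancel]
        ring
      have h2 : ∑ i ∈ Finset.Icc 1 n, w i (s + 1)
          ≤ ∑ i ∈ Finset.Icc 1 n, (w i s + 1 / 3 * (w i s * d (s + 1) i)) := by
        refine Finset.sum_le_sum fun i hi => ?_
        rw [hw (s + 1) hm i hi, Nat.add_sub_cancel]
        have hdi := hd (s + 1) hm i hi
        have hb : (1 + 1 / 3 : ℝ) ^ (d (s + 1) i) ≤ 1 + d (s + 1) i * (1 / 3) :=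
          rpow_one_add_le_one_add_mul_self (by norm_num) hdi.1 hdi.2
        have := mul_le_mul_of_nonneg_left hb (hpos s (by omega) i hi).le
        linarith
      rw [Finset.sum_add_distrib, ← Finset.mul_sum] at h2
      have h3 : ε / 3 + 1 ≤ Real.exp (ε / 3) := Real.add_one_le_exp _
      have h4 : Real.exp (ε / 3 * ((s + 1 : ℕ) : ℝ))
          = Real.exp (ε / 3) * Real.exp (ε / 3 * s) := by
        rw [← Real.exp_add]; push_cast; ring_nf
      rw [h4]
      calc ∑ i ∈ Finset.Icc 1 n, w i (s + 1)
          ≤ (ε / 3 + 1) * ∑ i ∈ Finset.Icc 1 n, w i s := by linarith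
        _ ≤ _ := mul_le_mul h3 ih' hWpos.le (Real.exp_pos _).le
  refine Finset.sup'_le _ _ fun i hi => ?_
  have hS0 : 0 ≤ ∑ t ∈ Finset.Icc 1 T, d t i :=
    Finset.sum_nonneg fun t ht => (hd t ht i hi).1
  have h1 : w i T ≤ Real.exp (ε / 3 * T) :=
    (Finset.single_le_sum (f := fun j => w j T)
      (fun j hj => (hpos T le_rfl j hj).le) hi).trans (hW T le_rfl)
  have h2 := Real.log_le_log (hpos T le_rfl i hi) h1
  rw [Real.log_exp, hclosed T le_rfl i hi, Real.log_mul (by positivity) (by positivity),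
    Real.log_rpow (by norm_num), one_div, Real.log_inv] at h2
  have h3 : (1 / 4 : ℝ) ≤ Real.log (1 + 1 / 3) := by
    have := Real.one_sub_inv_le_log_of_pos (x := (1 + 1 / 3 : ℝ)) (by norm_num)
    norm_num at this ⊢
    linarith
  have h4 := mul_le_mul_of_nonneg_left h3 hS0
  rw [div_le_iff₀ hε0] at hTε
  rw [one_div, inv_mul_le_iff₀ hT0]
  norm_num at h2 h4
  nlinarith [mul_pos hT0 hε0]
end

section
/- For every i ∈ {1,…,n}, the output satisfies |G_T(i) − (1/T) ∑_{t=1}^T v_t(i)| ≤ ε. (Correctness of the multiplicative-weights algorithm for CDF estimation with k simultaneous threshold queries per round.) -/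
/-- Bracketing: some consecutive pair of query points surrounds `i`. -/
lemma mw_bracket (q : ℕ → ℕ) (i : ℕ) (h0 : q 0 ≤ i) :
    ∀ m : ℕ, i < q m → ∃ j < m, q j ≤ i ∧ i < q (j + 1) := by
  intro m
  induction m with
  | zero => intro h; omega
  | succ m ih =>
    intro h
    by_cases hm : i < q m
    · obtain ⟨j, hj, h1⟩ := ih hm
      exact ⟨j, by omega, h1⟩
    · exact ⟨m, by omega, by omega, h⟩

/-- The bounds `ℓ ≤ v ≤ u`, and comparison of `ℓ`, `u` with queried values. -/
lemma mw_bounds (n k : ℕ) (v : ℕ → ℝ) (q : ℕ → ℕ) (ℓ u : ℝ) (i : ℕ)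
    (hi : i ∈ Finset.Icc 1 n)
    (hv01 : ∀ i ≤ n + 1, v i ∈ Set.Icc (0 : ℝ) 1)
    (hvmono : ∀ i j : ℕ, i ≤ j → j ≤ n + 1 → v i ≤ v j)
    (hq0 : q 0 = 0) (hqtop : q (k + 1) = n + 1)
    (hqn : ∀ j ≤ k + 1, q j ≤ n + 1)
    (hℓ : ℓ = sSup {y | ∃ j ≤ k + 1, q j ≤ i ∧ y = v (q j)})
    (hu : u = sInf {y | ∃ j ≤ k + 1, i ≤ q j ∧ y = v (q j)}) :
    ℓ ≤ v i ∧ v i ≤ u ∧ (∀ j ≤ k + 1, q j ≤ i → v (q j) ≤ ℓ) ∧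
      (∀ j ≤ k + 1, i ≤ q j → u ≤ v (q j)) := by
  rw [Finset.mem_Icc] at hi
  refine ⟨?_, ?_, ?_, ?_⟩
  · rw [hℓ]
    apply csSup_le
    · exact ⟨_, 0, by omega, by omega, rfl⟩
    · rintro y ⟨j, hj, hji, rfl⟩
      exact hvmono _ _ hji (by omega)
  · rw [hu]
    apply le_csInf
    · exact ⟨_, k + 1, le_rfl, by omega, rfl⟩
    · rintro y ⟨j, hj, hji, rfl⟩
      exact hvmono _ _ hji (hqn j hj)
  · intro j hj hji
    rw [hℓ]
    apply le_csSup
    · refine ⟨1, ?_⟩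
      rintro y ⟨j, hj, hji, rfl⟩
      exact (hv01 _ (hqn j hj)).2
    · exact ⟨j, hj, hji, rfl⟩
  · intro j hj hji
    rw [hu]
    apply csInf_le
    · refine ⟨0, ?_⟩
      rintro y ⟨j, hj, hji, rfl⟩
      exact (hv01 _ (hqn j hj)).1
    · exact ⟨j, hj, hji, rfl⟩

/-- One round of the algorithm: the average uncertainty is at most `1/(k+1)`. -/
lemma mw_round (n k : ℕ) (v : ℕ → ℝ)
    (hv01 : ∀ i ≤ n + 1, v i ∈ Set.Icc (0 : ℝ) 1)
    (hvmono : ∀ i j : ℕ, i ≤ j → j ≤ n + 1 → v i ≤ v j)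
    (hv0 : v 0 = 0) (hvtop : v (n + 1) = 1)
    (a : ℕ → ℝ) (ha : ∀ i ∈ Finset.Icc 1 n, 0 ≤ a i)
    (ha1 : ∑ i ∈ Finset.Icc 1 n, a i = 1)
    (q : ℕ → ℕ) (hq0 : q 0 = 0) (hqtop : q (k + 1) = n + 1)
    (hq : ∀ j ∈ Finset.Icc 1 k,
      q j = sInf {x | x ∈ Finset.Icc 1 n ∧
        (j : ℝ) / ((k : ℝ) + 1) ≤ ∑ i ∈ Finset.Icc 1 x, a i})
    (ℓ u : ℕ → ℝ)
    (hℓ : ∀ i ∈ Finset.Icc 1 n, ℓ i = sSup {y | ∃ j ≤ k + 1, q j ≤ i ∧ y = v (q j)})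
    (hu : ∀ i ∈ Finset.Icc 1 n, u i = sInf {y | ∃ j ≤ k + 1, i ≤ q j ∧ y = v (q j)}) :
    (∀ i ∈ Finset.Icc 1 n, ℓ i ≤ v i ∧ v i ≤ u i ∧ u i - ℓ i ≤ 1) ∧
      ∑ i ∈ Finset.Icc 1 n, a i * (u i - ℓ i) ≤ 1 / ((k : ℝ) + 1) := by
  have hkpos : (0 : ℝ) < (k : ℝ) + 1 := by positivity
  have hn : 1 ≤ n := by
    by_contra h
    have : n = 0 := by omega
    subst this
    simp at ha1
  have hmem : ∀ j ∈ Finset.Icc 1 k, q j ∈ {x | x ∈ Finset.Icc 1 n ∧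
        (j : ℝ) / ((k : ℝ) + 1) ≤ ∑ i ∈ Finset.Icc 1 x, a i} := by
    intro j hj
    rw [hq j hj]
    apply Nat.sInf_mem
    refine ⟨n, Finset.mem_Icc.2 ⟨hn, le_rfl⟩, ?_⟩
    rw [ha1, div_le_one hkpos]
    have : j ≤ k := (Finset.mem_Icc.1 hj).2
    have : (j : ℝ) ≤ k := by exact_mod_cast this
    linarith
  have hmin : ∀ j ∈ Finset.Icc 1 k, ∀ x, x ∈ Finset.Icc 1 n →
        (j : ℝ) / ((k : ℝ) + 1) ≤ ∑ i ∈ Finset.Icc 1 x, a i → q j ≤ x := by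
    intro j hj x hx h
    rw [hq j hj]
    exact Nat.sInf_le ⟨hx, h⟩
  have hqn : ∀ j ≤ k + 1, q j ≤ n + 1 := by
    intro j hj
    rcases Nat.eq_zero_or_pos j with rfl | h0
    · omega
    rcases Nat.lt_or_ge k j with h | h
    · have : j = k + 1 := by omega
      subst this; omega
    · have := (Finset.mem_Icc.1 (hmem j (Finset.mem_Icc.2 ⟨h0, h⟩)).1).2
      omega
  have hlow : ∀ j ≤ k, (j : ℝ) / ((k : ℝ) + 1) ≤ ∑ i ∈ Finset.Icc 1 (q j), a i := by
    intro j hj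
    rcases Nat.eq_zero_or_pos j with rfl | h0
    · simp [hq0]
    · exact (hmem j (Finset.mem_Icc.2 ⟨h0, hj⟩)).2
  have hup : ∀ j ≤ k, ∀ x ≤ n, x < q (j + 1) →
      ∑ i ∈ Finset.Icc 1 x, a i ≤ ((j : ℝ) + 1) / ((k : ℝ) + 1) := by
    intro j hj x hx hxq
    rcases Nat.eq_zero_or_pos x with rfl | h0
    · simp; positivity
    rcases Nat.lt_or_ge j k with h | h
    · by_contra hcon
      push Not at hcon
      have := hmin (j + 1) (Finset.mem_Icc.2 ⟨by omega, by omega⟩) x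
        (Finset.mem_Icc.2 ⟨h0, hx⟩) (by push_cast; exact hcon.le)
      omega
    · have : j = k := by omega
      subst this
      rw [div_self hkpos.ne', ← ha1]
      apply Finset.sum_le_sum_of_subset_of_nonneg
      · exact Finset.Icc_subset_Icc le_rfl hx
      · intro i hi _; exact ha i hi
  have hqmono : ∀ j ≤ k, q j ≤ q (j + 1) := by
    intro j hj
    rcases Nat.eq_zero_or_pos j with rfl | h0
    · omega
    rcases Nat.lt_or_ge j k with h | h
    · have h1 := hmem (j + 1) (Finset.mem_Icc.2 ⟨by omega, by omega⟩)
      refine hmin j (Finset.mem_Icc.2 ⟨h0, hj⟩) _ h1.1 (le_trans ?_ h1.2)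
      push_cast
      gcongr
      linarith
    · have : j = k := by omega
      subst this
      rw [hqtop]; exact hqn j (by omega)
  have hb := fun i hi => mw_bounds n k v q (ℓ i) (u i) i hi hv01 hvmono hq0 hqtop hqn
    (hℓ i hi) (hu i hi)
  have hΔ : ∀ j ∈ Finset.range (k + 1), 0 ≤ v (q (j + 1)) - v (q j) := by
    intro j hj
    rw [Finset.mem_range] at hj
    have := hvmono _ _ (hqmono j (by omega)) (hqn (j + 1) (by omega))
    linarith
  refine ⟨?_, ?_⟩
  · intro i hi
    obtain ⟨h1, h2, h3, h4⟩ := hb i hi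
    have hi' := Finset.mem_Icc.1 hi
    refine ⟨h1, h2, ?_⟩
    have h5 := h3 0 (by omega) (by omega)
    have h6 := h4 (k + 1) le_rfl (by omega)
    rw [hq0, hv0] at h5
    rw [hqtop, hvtop] at h6
    linarith
  have hd : ∀ i ∈ Finset.Icc 1 n, u i - ℓ i ≤ ∑ j ∈ Finset.range (k + 1),
      if q j < i ∧ i < q (j + 1) then v (q (j + 1)) - v (q j) else 0 := by
    intro i hi
    obtain ⟨h1, h2, h3, h4⟩ := hb i hi
    have hi' := Finset.mem_Icc.1 hi
    have hnn : ∀ j ∈ Finset.range (k + 1),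
        0 ≤ if q j < i ∧ i < q (j + 1) then v (q (j + 1)) - v (q j) else 0 := by
      intro j hj
      split_ifs
      · exact hΔ j hj
      · exact le_rfl
    obtain ⟨j, hj, hj1, hj2⟩ := mw_bracket q i (by omega) (k + 1) (by omega)
    have h5 := h3 j (by omega) hj1
    rcases hj1.eq_or_lt with he | hlt
    · have h6 := h4 j (by omega) he.ge
      have := Finset.sum_nonneg hnn
      linarith
    · have h6 := h4 (j + 1) (by omega) hj2.le
      have h7 := Finset.single_le_sum hnn (Finset.mem_range.2 hj)
      rw [if_pos ⟨hlt, hj2⟩] at h7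
      linarith
  have hmass : ∀ j ∈ Finset.range (k + 1),
      ∑ i ∈ Finset.Icc 1 n, (if q j < i ∧ i < q (j + 1) then a i else 0)
        ≤ 1 / ((k : ℝ) + 1) := by
    intro j hj
    rw [Finset.mem_range] at hj
    have hjk : j ≤ k := by omega
    rw [← Finset.sum_filter]
    by_cases hc : q j < q (j + 1)
    · have hqj := hqn (j + 1) (by omega)
      have hs : Finset.Icc 1 (q (j + 1) - 1) = Finset.Icc 1 (q j) ∪
          (Finset.Icc 1 n).filter (fun i => q j < i ∧ i < q (j + 1)) := by
        ext i
        simp only [Finset.mem_Icc, Finset.mem_union, Finset.mem_filter]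
        omega
      have hdis : Disjoint (Finset.Icc 1 (q j))
          ((Finset.Icc 1 n).filter (fun i => q j < i ∧ i < q (j + 1))) := by
        rw [Finset.disjoint_left]
        intro i h1 h2
        simp only [Finset.mem_Icc, Finset.mem_filter] at h1 h2
        omega
      have h1 := hup j hjk (q (j + 1) - 1) (by omega) (by omega)
      rw [hs, Finset.sum_union hdis] at h1
      have h2 := hlow j hjk
      rw [add_div] at h1
      linarith
    · rw [Finset.filter_false_of_mem (by intro i _; omega)]
      simp; positivity
  calc ∑ i ∈ Finset.Icc 1 n, a i * (u i - ℓ i)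
      ≤ ∑ i ∈ Finset.Icc 1 n, a i * ∑ j ∈ Finset.range (k + 1),
        (if q j < i ∧ i < q (j + 1) then v (q (j + 1)) - v (q j) else 0) :=
        Finset.sum_le_sum fun i hi => mul_le_mul_of_nonneg_left (hd i hi) (ha i hi)
    _ = ∑ j ∈ Finset.range (k + 1), (v (q (j + 1)) - v (q j)) *
        ∑ i ∈ Finset.Icc 1 n, (if q j < i ∧ i < q (j + 1) then a i else 0) := by
        simp_rw [Finset.mul_sum]
        rw [Finset.sum_comm]
        refine Finset.sum_congr rfl fun j _ => Finset.sum_congr rfl fun i _ => ?_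
        split_ifs
        · ring
        · simp
    _ ≤ ∑ j ∈ Finset.range (k + 1), (v (q (j + 1)) - v (q j)) * (1 / ((k : ℝ) + 1)) :=
        Finset.sum_le_sum fun j hj => mul_le_mul_of_nonneg_left (hmass j hj) (hΔ j hj)
    _ = 1 / ((k : ℝ) + 1) := by
        rw [← Finset.sum_mul, Finset.sum_range_sub (fun j => v (q j)), hqtop, hq0, hv0, hvtop]
        ring


/-- Correctness of the multiplicative-weights algorithm for CDF estimation with
`k` simultaneous threshold queries per round: with `k + 1 ≥ 1/ε` and
`T ≥ 9 ln n / ε`, against arbitrary monotone `v t : {0,…,n+1} → [0,1]`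
(with `v t 0 = 0`, `v t (n+1) = 1`), the algorithm that maintains weights
`w i 0 = 1/n`, `a i t = w i (t-1)/∑ w i' (t-1)`, queries
`q t j = min { x ∈ {1,…,n} : ∑_{i≤x} a i t ≥ j/(k+1) }` (with `q t 0 = 0`,
`q t (k+1) = n+1`), observes `ℓ t i`, `u t i` (the tightest lower/upper bounds
from the queried values), sets `d t i = u t i − ℓ t i` and updates
`w i t = w i (t-1) * (4/3)^(d t i)`, outputs
`G i = (1/(2T)) ∑_t (ℓ t i + u t i)` satisfying
`|G i − (1/T) ∑_t v t i| ≤ ε` for all `i ∈ {1,…,n}`. -/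
theorem mw_cdf_estimation (n k T : ℕ) (hn : 2 ≤ n) (hk : 1 ≤ k) (hT : 1 ≤ T)
    (ε : ℝ) (hε0 : 0 < ε) (hε1 : ε < 1)
    (hkε : 1 / ε ≤ (k : ℝ) + 1)
    (hTε : 9 * Real.log n / ε ≤ (T : ℝ))
    (v : ℕ → ℕ → ℝ)
    (hv01 : ∀ t ∈ Finset.Icc 1 T, ∀ i ≤ n + 1, v t i ∈ Set.Icc (0 : ℝ) 1)
    (hvmono : ∀ t ∈ Finset.Icc 1 T, ∀ i j : ℕ, i ≤ j → j ≤ n + 1 → v t i ≤ v t j)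
    (hv0 : ∀ t ∈ Finset.Icc 1 T, v t 0 = 0)
    (hvtop : ∀ t ∈ Finset.Icc 1 T, v t (n + 1) = 1)
    (w : ℕ → ℕ → ℝ) (a : ℕ → ℕ → ℝ) (q : ℕ → ℕ → ℕ)
    (ℓ u d : ℕ → ℕ → ℝ) (G : ℕ → ℝ)
    (hw0 : ∀ i ∈ Finset.Icc 1 n, w i 0 = 1 / (n : ℝ))
    (ha : ∀ t ∈ Finset.Icc 1 T, ∀ i ∈ Finset.Icc 1 n,
      a i t = w i (t - 1) / ∑ i' ∈ Finset.Icc 1 n, w i' (t - 1))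
    (hq0 : ∀ t ∈ Finset.Icc 1 T, q t 0 = 0)
    (hqtop : ∀ t ∈ Finset.Icc 1 T, q t (k + 1) = n + 1)
    (hq : ∀ t ∈ Finset.Icc 1 T, ∀ j ∈ Finset.Icc 1 k,
      q t j = sInf {x | x ∈ Finset.Icc 1 n ∧
        (j : ℝ) / ((k : ℝ) + 1) ≤ ∑ i ∈ Finset.Icc 1 x, a i t})
    (hℓ : ∀ t ∈ Finset.Icc 1 T, ∀ i ∈ Finset.Icc 1 n,
      ℓ t i = sSup {y | ∃ j ≤ k + 1, q t j ≤ i ∧ y = v t (q t j)})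
    (hu : ∀ t ∈ Finset.Icc 1 T, ∀ i ∈ Finset.Icc 1 n,
      u t i = sInf {y | ∃ j ≤ k + 1, i ≤ q t j ∧ y = v t (q t j)})
    (hd : ∀ t ∈ Finset.Icc 1 T, ∀ i ∈ Finset.Icc 1 n, d t i = u t i - ℓ t i)
    (hw : ∀ t ∈ Finset.Icc 1 T, ∀ i ∈ Finset.Icc 1 n,
      w i t = w i (t - 1) * ((4 : ℝ) / 3) ^ (d t i))
    (hG : ∀ i ∈ Finset.Icc 1 n,
      G i = (1 / (2 * (T : ℝ))) * ∑ t ∈ Finset.Icc 1 T, (ℓ t i + u t i)) :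
    ∀ i ∈ Finset.Icc 1 n,
      |G i - (1 / (T : ℝ)) * ∑ t ∈ Finset.Icc 1 T, v t i| ≤ ε := by
  have hnpos : (0 : ℝ) < n := by exact_mod_cast (by omega : 0 < n)
  have hTpos : (0 : ℝ) < T := by exact_mod_cast (by omega : 0 < T)
  have hne : (Finset.Icc 1 n).Nonempty := ⟨1, Finset.mem_Icc.2 ⟨le_rfl, by omega⟩⟩
  have hwpos : ∀ t ≤ T, ∀ i ∈ Finset.Icc 1 n, 0 < w i t := by
    intro t
    induction t with
    | zero => intro _ i hi; rw [hw0 i hi]; positivity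
    | succ t ih =>
      intro ht i hi
      rw [hw (t + 1) (Finset.mem_Icc.2 ⟨by omega, ht⟩) i hi]
      have := ih (by omega) i hi
      rw [Nat.add_sub_cancel]
      positivity
  have hWpos : ∀ t ≤ T, 0 < ∑ i ∈ Finset.Icc 1 n, w i t := fun t ht =>
    Finset.sum_pos (hwpos t ht) hne
  have hkε' : 1 / ((k : ℝ) + 1) ≤ ε := by
    rw [div_le_iff₀ hε0] at hkε
    rw [div_le_iff₀ (by positivity)]
    linarith
  have hround : ∀ t ∈ Finset.Icc 1 T,
      (∀ i ∈ Finset.Icc 1 n, ℓ t i ≤ v t i ∧ v t i ≤ u t i ∧ u t i - ℓ t i ≤ 1) ∧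
      ∑ i ∈ Finset.Icc 1 n, a i t * (u t i - ℓ t i) ≤ 1 / ((k : ℝ) + 1) := by
    intro t ht
    have ht' := Finset.mem_Icc.1 ht
    have hW := hWpos (t - 1) (by omega)
    refine mw_round n k (v t) (hv01 t ht) (hvmono t ht) (hv0 t ht) (hvtop t ht)
      (fun i => a i t) ?_ ?_ (q t) (hq0 t ht) (hqtop t ht) (hq t ht) (ℓ t) (u t)
      (hℓ t ht) (hu t ht)
    · intro i hi
      have := hwpos (t - 1) (by omega) i hi
      simp only [ha t ht i hi]
      positivity
    · rw [Finset.sum_congr rfl (ha t ht), ← Finset.sum_div, div_self hW.ne']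
  have hW : ∀ t ≤ T, ∑ i ∈ Finset.Icc 1 n, w i t ≤ Real.exp (ε / 3 * t) := by
    intro t
    induction t with
    | zero =>
      intro _
      rw [Finset.sum_congr rfl hw0]
      simp [hnpos.ne']
    | succ t ih =>
      intro ht
      have htm : t + 1 ∈ Finset.Icc 1 T := Finset.mem_Icc.2 ⟨by omega, ht⟩
      have hWt := hWpos t (by omega)
      obtain ⟨hr1, hr2⟩ := hround (t + 1) htm
      have h1 : ∀ i ∈ Finset.Icc 1 n, w i (t + 1) ≤ w i t +
          (1 / 3) * (∑ i ∈ Finset.Icc 1 n, w i t) *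
            (a i (t + 1) * (u (t + 1) i - ℓ (t + 1) i)) := by
        intro i hi
        obtain ⟨h1, h2, h3⟩ := hr1 i hi
        have hwp := hwpos t (by omega) i hi
        have hb := rpow_one_add_le_one_add_mul_self (s := 1 / 3)
          (p := u (t + 1) i - ℓ (t + 1) i) (by norm_num) (by linarith) h3
        rw [hw (t + 1) htm i hi, ha (t + 1) htm i hi, hd (t + 1) htm i hi, Nat.add_sub_cancel]
        rw [show (1 + 1 / 3 : ℝ) = 4 / 3 by norm_num] at hb
        refine (mul_le_mul_of_nonneg_left hb hwp.le).trans (le_of_eq ?_)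
        field_simp
      have h2 := Finset.sum_le_sum h1
      rw [Finset.sum_add_distrib, ← Finset.mul_sum] at h2
      have h3 : ∑ i ∈ Finset.Icc 1 n, w i (t + 1) ≤
          (∑ i ∈ Finset.Icc 1 n, w i t) * (ε / 3 + 1) := by
        have := mul_le_mul_of_nonneg_left (hr2.trans hkε') hWt.le
        nlinarith
      calc _ ≤ _ := h3
        _ ≤ Real.exp (ε / 3 * t) * Real.exp (ε / 3) := by
          gcongr
          · exact ih (by omega)
          · exact Real.add_one_le_exp _
        _ = _ := by rw [← Real.exp_add]; push_cast; ring_nf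
  have hlogw : ∀ i ∈ Finset.Icc 1 n, ∀ t ≤ T,
      Real.log (w i t) = - Real.log n + Real.log (4 / 3) * ∑ s ∈ Finset.Icc 1 t, d s i := by
    intro i hi t
    induction t with
    | zero => intro _; rw [hw0 i hi]; simp
    | succ t ih =>
      intro ht
      have hwp := hwpos t (by omega) i hi
      rw [hw (t + 1) (Finset.mem_Icc.2 ⟨by omega, ht⟩) i hi, Nat.add_sub_cancel,
        Real.log_mul hwp.ne' (by positivity), ih (by omega), Real.log_rpow (by norm_num),
        Finset.sum_Icc_succ_top (by omega)]
      ring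
  intro i hi
  have hdn : ∀ t ∈ Finset.Icc 1 T, 0 ≤ d t i := by
    intro t ht
    obtain ⟨h1, h2, _⟩ := (hround t ht).1 i hi
    rw [hd t ht i hi]; linarith
  have hDn := Finset.sum_nonneg hdn
  have hD : ∑ t ∈ Finset.Icc 1 T, d t i ≤ 2 * ε * T := by
    have h1 : w i T ≤ Real.exp (ε / 3 * T) :=
      (Finset.single_le_sum (fun j hj => (hwpos T le_rfl j hj).le) hi).trans (hW T le_rfl)
    have h2 := Real.log_le_log (hwpos T le_rfl i hi) h1
    rw [Real.log_exp, hlogw i hi T le_rfl] at h2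
    rw [div_le_iff₀ hε0] at hTε
    have h3 : (1 / 4 : ℝ) ≤ Real.log (4 / 3) := by
      have := Real.one_sub_inv_le_log_of_pos (x := 4 / 3) (by norm_num)
      norm_num at this ⊢
      linarith
    have h4 := mul_le_mul_of_nonneg_right h3 hDn
    have : 0 < ε * T := by positivity
    nlinarith
  have hkey : |∑ t ∈ Finset.Icc 1 T, ((ℓ t i + u t i) / 2 - v t i)|
      ≤ ∑ t ∈ Finset.Icc 1 T, d t i / 2 := by
    refine (Finset.abs_sum_le_sum_abs _ _).trans (Finset.sum_le_sum fun t ht => ?_)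
    obtain ⟨h1, h2, _⟩ := (hround t ht).1 i hi
    rw [hd t ht i hi, abs_le]
    constructor <;> linarith
  have hGe : G i - (1 / (T : ℝ)) * ∑ t ∈ Finset.Icc 1 T, v t i =
      (∑ t ∈ Finset.Icc 1 T, ((ℓ t i + u t i) / 2 - v t i)) / T := by
    rw [hG i hi, Finset.sum_sub_distrib, ← Finset.sum_div]
    field_simp
  rw [hGe, abs_div, abs_of_pos hTpos, div_le_iff₀ hTpos]
  rw [← Finset.sum_div] at hkey
  linarith
end

section
/- If θ and θ' are any two distinct elements of {1,…,m}^k, then max_{i ∈ {1,…,n}} |F_θ(i) − F_{θ'}(i)| = 3ε. -/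
/-- Context: `n = k·m`, `ε = 1/(6k)`, and for `θ ∈ {1,…,m}^k` the CDF `F_θ` is
defined on `i = (a−1)m + b` (with `a ∈ {1,…,k}`, `b ∈ {1,…,m}`) by
`F_θ(i) = 1/4 + 3(a−1)ε` if `b < θ_a`, `F_θ(i) = 1/4 + 3aε` if `b ≥ θ_a` and
`i < n`, and `F_θ(n) = 1`.
Statement: if `θ ≠ θ'` then `max_{i ∈ {1,…,n}} |F_θ(i) − F_{θ'}(i)| = 3ε`. -/
theorem ftheta_dist_eq (k m : ℕ) (hk : 0 < k) (hm : 0 < m)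
    (n : ℕ) (hn : n = k * m)
    (ε : ℝ) (hε : ε = 1 / (6 * (k : ℝ)))
    (θ θ' : ℕ → ℕ)
    (hθ : ∀ a ∈ Finset.Icc 1 k, θ a ∈ Finset.Icc 1 m)
    (hθ' : ∀ a ∈ Finset.Icc 1 k, θ' a ∈ Finset.Icc 1 m)
    (F F' : ℕ → ℝ)
    (hF : ∀ a ∈ Finset.Icc 1 k, ∀ b ∈ Finset.Icc 1 m,
      F ((a - 1) * m + b) =
        if b < θ a then 1 / 4 + 3 * ((a : ℝ) - 1) * ε
        else if (a - 1) * m + b < n then 1 / 4 + 3 * (a : ℝ) * ε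
        else 1)
    (hF' : ∀ a ∈ Finset.Icc 1 k, ∀ b ∈ Finset.Icc 1 m,
      F' ((a - 1) * m + b) =
        if b < θ' a then 1 / 4 + 3 * ((a : ℝ) - 1) * ε
        else if (a - 1) * m + b < n then 1 / 4 + 3 * (a : ℝ) * ε
        else 1)
    (hne : ∃ a ∈ Finset.Icc 1 k, θ a ≠ θ' a) :
    (Finset.Icc 1 n).sup' (Finset.nonempty_Icc.mpr (hn ▸ Nat.mul_pos hk hm))
      (fun i => |F i - F' i|) = 3 * ε := by
  have hε0 : 0 < ε := by
    rw [hε]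
    have : (0 : ℝ) < k := by exact_mod_cast hk
    positivity
  -- an index with `b < m` lies strictly below `n`
  have hlt : ∀ a ∈ Finset.Icc 1 k, ∀ b, b < m → (a - 1) * m + b < n := by
    intro a ha b hb
    rw [Finset.mem_Icc] at ha
    have h1 : (a - 1) * m + m ≤ k * m := by
      calc (a - 1) * m + m = (a - 1 + 1) * m := by ring
        _ ≤ k * m := Nat.mul_le_mul_right m (by omega)
    omega
  apply le_antisymm
  · apply Finset.sup'_le
    intro i hi
    rw [Finset.mem_Icc] at hi
    obtain ⟨a, ha, b, hb, rfl⟩ : ∃ a ∈ Finset.Icc 1 k, ∃ b ∈ Finset.Icc 1 m,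
        i = (a - 1) * m + b := by
      refine ⟨(i - 1) / m + 1, ?_, (i - 1) % m + 1, ?_, ?_⟩
      · have : (i - 1) / m < k := (Nat.div_lt_iff_lt_mul hm).2 (by omega)
        exact Finset.mem_Icc.2 ⟨Nat.le_add_left _ _, this⟩
      · have := Nat.mod_lt (i - 1) hm
        rw [Finset.mem_Icc]; omega
      · have := Nat.div_add_mod' (i - 1) m
        rw [Nat.add_sub_cancel]; omega
    have h1 := Finset.mem_Icc.1 (hθ a ha)
    have h2 := Finset.mem_Icc.1 (hθ' a ha)
    have h3 := hlt a ha b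
    show |F _ - F' _| ≤ _
    rw [hF a ha b hb, hF' a ha b hb, abs_le]
    split_ifs <;> first | omega | (constructor <;> nlinarith)
  · obtain ⟨a, ha, hab⟩ := hne
    have h1 := Finset.mem_Icc.1 (hθ a ha)
    have h2 := Finset.mem_Icc.1 (hθ' a ha)
    have key : ∀ b, b = min (θ a) (θ' a) → 3 * ε ≤ |F ((a - 1) * m + b) - F' ((a - 1) * m + b)| := by
      intro b hbe
      have hb : b ∈ Finset.Icc 1 m := by rw [Finset.mem_Icc]; omega
      have h3 := hlt a ha b (by omega)
      rw [hF a ha b hb, hF' a ha b hb, le_abs]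
      split_ifs
      · omega
      · right; linarith
      · left; linarith
      · omega
    have h3 := hlt a ha (min (θ a) (θ' a)) (by omega)
    refine (key _ rfl).trans (Finset.le_sup' (fun i => |F i - F' i|) ?_)
    rw [Finset.mem_Icc]
    omega
end

section
/- For any function F̂ : {1,…,n} → ℝ there is at most one θ ∈ {1,…,m}^k satisfying max_{i ∈ {1,…,n}} |F̂(i) − F_θ(i)| < 3ε/2; that is, if θ, θ' ∈ {1,…,m}^k both satisfy max_i |F̂(i) − F_θ(i)| < 3ε/2 and max_i |F̂(i) − F_{θ'}(i)| < 3ε/2, then θ = θ'. -/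
theorem ftheta_aux (k m : ℕ) (n : ℕ) (hn : n = k * m) (ε : ℝ)
    (θ θ' : ℕ → ℕ)
    (hθ : ∀ a ∈ Finset.Icc 1 k, θ a ∈ Finset.Icc 1 m)
    (hθ' : ∀ a ∈ Finset.Icc 1 k, θ' a ∈ Finset.Icc 1 m)
    (F F' : ℕ → ℝ)
    (hF : ∀ a ∈ Finset.Icc 1 k, ∀ b ∈ Finset.Icc 1 m,
      F ((a - 1) * m + b) =
        if b < θ a then 1 / 4 + 3 * ((a : ℝ) - 1) * ε
        else if (a - 1) * m + b < n then 1 / 4 + 3 * (a : ℝ) * ε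
        else 1)
    (hF' : ∀ a ∈ Finset.Icc 1 k, ∀ b ∈ Finset.Icc 1 m,
      F' ((a - 1) * m + b) =
        if b < θ' a then 1 / 4 + 3 * ((a : ℝ) - 1) * ε
        else if (a - 1) * m + b < n then 1 / 4 + 3 * (a : ℝ) * ε
        else 1)
    (Fhat : ℕ → ℝ)
    (hc : ∀ i ∈ Finset.Icc 1 n, |Fhat i - F i| < 3 * ε / 2)
    (hc' : ∀ i ∈ Finset.Icc 1 n, |Fhat i - F' i| < 3 * ε / 2)
    (a : ℕ) (ha : a ∈ Finset.Icc 1 k) : ¬ θ a < θ' a := by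
  intro hlt
  have h1 := hF a ha (θ a) (hθ a ha)
  have h2 := hF' a ha (θ a) (hθ a ha)
  have hb := Finset.mem_Icc.mp (hθ a ha)
  have hb' := Finset.mem_Icc.mp (hθ' a ha)
  have ha' := Finset.mem_Icc.mp ha
  have hin : (a - 1) * m + θ a < n := by
    have e : (a - 1) * m + m = a * m := by
      rw [← Nat.succ_mul, Nat.succ_eq_add_one, Nat.sub_add_cancel ha'.1]
    have := Nat.mul_le_mul_right m ha'.2
    omega
  have hmem : (a - 1) * m + θ a ∈ Finset.Icc 1 n :=
    Finset.mem_Icc.mpr ⟨by omega, hin.le⟩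
  have c1 := abs_lt.mp (hc _ hmem)
  have c2 := abs_lt.mp (hc' _ hmem)
  rw [if_neg (lt_irrefl _), if_pos hin] at h1
  rw [if_pos hlt] at h2
  rw [h1] at c1
  rw [h2] at c2
  linarith [c1.1, c2.2]

/-- Context: `n = k·m`, `ε = 1/(6k)`, and for `θ ∈ {1,…,m}^k` the CDF `F_θ` is
defined on `i = (a−1)m + b` (with `a ∈ {1,…,k}`, `b ∈ {1,…,m}`) by
`F_θ(i) = 1/4 + 3(a−1)ε` if `b < θ_a`, `F_θ(i) = 1/4 + 3aε` if `b ≥ θ_a` and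
`i < n`, and `F_θ(n) = 1`.
Statement: for any `F̂ : {1,…,n} → ℝ` there is at most one `θ` with
`max_{i} |F̂(i) − F_θ(i)| < 3ε/2`: if both `θ` and `θ'` satisfy this bound,
then `θ = θ'`. -/
theorem ftheta_decode (k m : ℕ) (hk : 0 < k) (hm : 0 < m)
    (n : ℕ) (hn : n = k * m)
    (ε : ℝ) (hε : ε = 1 / (6 * (k : ℝ)))
    (θ θ' : ℕ → ℕ)
    (hθ : ∀ a ∈ Finset.Icc 1 k, θ a ∈ Finset.Icc 1 m)
    (hθ' : ∀ a ∈ Finset.Icc 1 k, θ' a ∈ Finset.Icc 1 m)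
    (F F' : ℕ → ℝ)
    (hF : ∀ a ∈ Finset.Icc 1 k, ∀ b ∈ Finset.Icc 1 m,
      F ((a - 1) * m + b) =
        if b < θ a then 1 / 4 + 3 * ((a : ℝ) - 1) * ε
        else if (a - 1) * m + b < n then 1 / 4 + 3 * (a : ℝ) * ε
        else 1)
    (hF' : ∀ a ∈ Finset.Icc 1 k, ∀ b ∈ Finset.Icc 1 m,
      F' ((a - 1) * m + b) =
        if b < θ' a then 1 / 4 + 3 * ((a : ℝ) - 1) * ε
        else if (a - 1) * m + b < n then 1 / 4 + 3 * (a : ℝ) * ε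
        else 1)
    (Fhat : ℕ → ℝ)
    (hclose : (Finset.Icc 1 n).sup' (Finset.nonempty_Icc.mpr (hn ▸ Nat.mul_pos hk hm))
      (fun i => |Fhat i - F i|) < 3 * ε / 2)
    (hclose' : (Finset.Icc 1 n).sup' (Finset.nonempty_Icc.mpr (hn ▸ Nat.mul_pos hk hm))
      (fun i => |Fhat i - F' i|) < 3 * ε / 2) :
    ∀ a ∈ Finset.Icc 1 k, θ a = θ' a := by
  have hc := (Finset.sup'_lt_iff _).mp hclose
  have hc' := (Finset.sup'_lt_iff _).mp hclose'
  intro a ha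
  have h1 := ftheta_aux k m n hn ε θ θ' hθ hθ' F F' hF hF' Fhat hc hc' a ha
  have h2 := ftheta_aux k m n hn ε θ' θ hθ' hθ F' F hF' hF Fhat hc' hc a ha
  omega
end

section
/- For all real numbers α ∈ [0,1] and β ∈ (0,1), kl(α, β) ≤ (α − β)² · (1/β + 1/(1−β)). -/
/-- Bernoulli Kullback–Leibler divergence `kl(α, β)`; since `Real.log 0 = 0`
and `0 * x = 0`, the convention that a term with zero coefficient vanishes
holds automatically. -/
noncomputable def klBer (α β : ℝ) : ℝ :=
  α * Real.log (α / β) + (1 - α) * Real.log ((1 - α) / (1 - β))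

theorem klBer_aux (a b : ℝ) (ha : 0 ≤ a) (hb : 0 < b) :
    a * Real.log (a / b) ≤ (a - b) ^ 2 * (1 / b) + (a - b) := by
  have h2 : (a - b) ^ 2 * (1 / b) + (a - b) = a * (a / b - 1) := by
    field_simp
    ring
  rw [h2]
  rcases ha.eq_or_lt with h | h
  · simp [← h]
  · exact mul_le_mul_of_nonneg_left (Real.log_le_sub_one_of_pos (div_pos h hb)) ha

/-- For `α ∈ [0,1]` and `β ∈ (0,1)`:
`kl(α, β) ≤ (α − β)² · (1/β + 1/(1−β))`. -/
theorem klBer_le_quadratic (α β : ℝ)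
    (hα0 : 0 ≤ α) (hα1 : α ≤ 1) (hβ0 : 0 < β) (hβ1 : β < 1) :
    klBer α β ≤ (α - β) ^ 2 * (1 / β + 1 / (1 - β)) := by
  have h1 := klBer_aux α β hα0 hβ0
  have h2 := klBer_aux (1 - α) (1 - β) (by linarith) (by linarith)
  have h3 : (1 - α - (1 - β)) ^ 2 = (α - β) ^ 2 := by ring
  rw [h3] at h2
  unfold klBer
  rw [mul_add]
  linarith
end

section
/- For all real numbers α and β with 1/2 ≤ α ≤ 1 and 0 < β ≤ 1/2, kl(α, β) ≥ (1/2)·ln(1/(4β)). -/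
/-- For `1/2 ≤ α ≤ 1` and `0 < β ≤ 1/2`:
`kl(α, β) ≥ (1/2)·ln(1/(4β))`. -/
theorem klBer_ge_log (α β : ℝ)
    (hα0 : 1 / 2 ≤ α) (hα1 : α ≤ 1) (hβ0 : 0 < β) (hβ1 : β ≤ 1 / 2) :
    klBer α β ≥ (1 / 2) * Real.log (1 / (4 * β)) := by
  have hH := Real.binEntropy_le_log_two (p := α)
  unfold Real.binEntropy at hH
  rw [Real.log_inv, Real.log_inv] at hH
  have hb : Real.log β ≤ 0 := Real.log_nonpos hβ0.le (by linarith)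
  have hb1 : Real.log (1 - β) ≤ 0 := Real.log_nonpos (by linarith) (by linarith)
  have e1 : Real.log (1 / (4 * β)) = -(2 * Real.log 2) - Real.log β := by
    rw [one_div, Real.log_inv, Real.log_mul (by norm_num) hβ0.ne',
      show (4 : ℝ) = 2 ^ 2 by norm_num, Real.log_pow]
    push_cast
    ring
  have e2 : Real.log (α / β) = Real.log α - Real.log β :=
    Real.log_div (by linarith) hβ0.ne'
  have e3 : (1 - α) * Real.log ((1 - α) / (1 - β))
      = (1 - α) * (Real.log (1 - α) - Real.log (1 - β)) := by
    rcases eq_or_lt_of_le hα1 with h | h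
    · simp [h]
    · rw [Real.log_div (by linarith) (by linarith)]
  unfold klBer
  rw [e1, e2, e3]
  nlinarith [mul_nonneg (sub_nonneg.2 hα0) (neg_nonneg.2 hb),
    mul_nonneg (sub_nonneg.2 hα1) (neg_nonneg.2 hb1)]
end

section
/- Let k be a positive integer and m ≥ 2 a real number. Let Ω_1, …, Ω_k be nonempty finite sets, and let p and q be probability distributions on Ω = Ω_1 × ⋯ × Ω_k which are both product distributions, p = p_1 × ⋯ × p_k and q = q_1 × ⋯ × q_k, with q(ω) > 0 for every ω ∈ Ω. Suppose there exists x* = (x*_1, …, x*_k) ∈ Ω with p({x*}) ≥ 1/2 and q_i({x*_i}) ≤ 1/m for every i ∈ {1,…,k}. Then KL(p‖q) ≥ (k/2)·ln(m/4). -/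
theorem tangent_aux (P Q T : ℝ) (hP : 0 ≤ P) (hQ : 0 < Q) (hT : 0 < T) :
    P * Real.log T + P - Q * T ≤ P * Real.log (P / Q) := by
  rcases hP.eq_or_lt with h | h
  · subst h
    have := mul_pos hQ hT
    simp
    linarith
  · have h1 := Real.log_le_sub_one_of_pos (show 0 < T / (P / Q) by positivity)
    rw [Real.log_div hT.ne' (by positivity)] at h1
    have h2 := mul_le_mul_of_nonneg_left h1 hP
    have h3 : P * (T / (P / Q) - 1) = Q * T - P := by
      field_simp
    rw [h3] at h2
    linarith

theorem marginal_aux (k : ℕ) (Ω : Fin k → Type) [∀ i, Fintype (Ω i)]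
    (p L : ∀ i, Ω i → ℝ) (hp1 : ∀ i, ∑ x, p i x = 1) (i : Fin k) :
    ∑ ω : ∀ i, Ω i, (∏ j, p j (ω j)) * L i (ω i) = ∑ x, p i x * L i x := by
  classical
  have h := Fintype.prod_sum (fun j x => p j x * (if j = i then L j x else 1))
  have h1 : ∀ ω : ∀ i, Ω i, ∏ j, (p j (ω j) * (if j = i then L j (ω j) else 1))
      = (∏ j, p j (ω j)) * L i (ω i) := by
    intro ω
    rw [Finset.prod_mul_distrib, Finset.prod_ite_eq' Finset.univ i (fun j => L j (ω j))]
    simp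
  simp only [h1] at h
  rw [← h, Finset.prod_eq_single i]
  · simp
  · intro j _ hj
    simp [hj, hp1]
  · simp

/-- Let `p = p_1 × ⋯ × p_k` and `q = q_1 × ⋯ × q_k` be product probability
distributions on a product `Ω = Ω_1 × ⋯ × Ω_k` of nonempty finite sets, with
`q` strictly positive. If there is `x*` with `p({x*}) ≥ 1/2` and
`q_i({x*_i}) ≤ 1/m` for all `i` (where `m ≥ 2`), then
`KL(p‖q) = ∑_ω p(ω) ln(p(ω)/q(ω)) ≥ (k/2)·ln(m/4)`. -/
theorem kl_product_lower_bound (k : ℕ) (hk : 0 < k) (m : ℝ) (hm : 2 ≤ m)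
    (Ω : Fin k → Type) [∀ i, Fintype (Ω i)] [∀ i, Nonempty (Ω i)]
    (p q : ∀ i, Ω i → ℝ)
    (hp0 : ∀ i x, 0 ≤ p i x) (hp1 : ∀ i, ∑ x, p i x = 1)
    (hq0 : ∀ i x, 0 ≤ q i x) (hq1 : ∀ i, ∑ x, q i x = 1)
    (hqpos : ∀ ω : ∀ i, Ω i, 0 < ∏ i, q i (ω i))
    (xstar : ∀ i, Ω i)
    (hpx : 1 / 2 ≤ ∏ i, p i (xstar i))
    (hqx : ∀ i, q i (xstar i) ≤ 1 / m) :
    ((k : ℝ) / 2) * Real.log (m / 4) ≤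
      ∑ ω : ∀ i, Ω i,
        (∏ i, p i (ω i)) * Real.log ((∏ i, p i (ω i)) / ∏ i, q i (ω i)) := by
  classical
  have hm0 : 0 < m := by linarith
  have hqp : ∀ i, 0 < q i (xstar i) := by
    intro i
    refine lt_of_le_of_ne (hq0 i _) (fun h => ?_)
    have := hqpos xstar
    rw [Finset.prod_eq_zero (Finset.mem_univ i) h.symm] at this
    exact lt_irrefl _ this
  have hple : ∀ i x, p i x ≤ 1 := by
    intro i x
    rw [← hp1 i]
    exact Finset.single_le_sum (fun y _ => hp0 i y) (Finset.mem_univ x)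
  have ha : ∀ i, 1 / 2 ≤ p i (xstar i) := by
    intro i
    refine hpx.trans ?_
    rw [← Finset.mul_prod_erase _ _ (Finset.mem_univ i)]
    exact mul_le_of_le_one_right (hp0 i _)
      (Finset.prod_le_one (fun j _ => hp0 j _) (fun j _ => hple j _))
  let t : ∀ i, Ω i → ℝ := fun i x => if x = xstar i then m / 2 else 1 / 2
  have ht : ∀ i x, 0 < t i x := by
    intro i x
    simp only [t]
    split_ifs <;> positivity
  have hP : ∑ ω : ∀ i, Ω i, ∏ i, p i (ω i) = 1 := by
    rw [← Fintype.prod_sum]; simp [hp1]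
  have hQT : ∑ ω : ∀ i, Ω i, (∏ i, q i (ω i)) * ∏ i, t i (ω i) ≤ 1 := by
    simp only [← Finset.prod_mul_distrib]
    rw [← Fintype.prod_sum (fun i x => q i x * t i x)]
    refine Finset.prod_le_one
      (fun i _ => Finset.sum_nonneg fun x _ => mul_nonneg (hq0 i x) (ht i x).le) ?_
    intro i _
    have h1 : ∀ x, q i x * t i x
        = q i x * (1 / 2) + (if x = xstar i then q i x * ((m - 1) / 2) else 0) := by
      intro x
      simp only [t]
      split_ifs <;> ring
    simp only [h1]
    rw [Finset.sum_add_distrib, ← Finset.sum_mul, hq1, Finset.sum_ite_eq' Finset.univ (xstar i)]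
    simp only [Finset.mem_univ, if_true]
    have h2 := hqx i
    rw [le_div_iff₀ hm0] at h2
    nlinarith [hqp i]
  have hL : ∀ i, (1 / 2) * Real.log (m / 4) ≤ ∑ x, p i x * Real.log (t i x) := by
    intro i
    have h1 : ∀ x, p i x * Real.log (t i x)
        = p i x * (-Real.log 2) + (if x = xstar i then p i x * Real.log m else 0) := by
      intro x
      simp only [t]
      split_ifs
      · rw [Real.log_div hm0.ne' (by norm_num)]; ring
      · rw [one_div, Real.log_inv]; ring
    simp only [h1]
    rw [Finset.sum_add_distrib, ← Finset.sum_mul, hp1, Finset.sum_ite_eq' Finset.univ (xstar i)]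
    simp only [Finset.mem_univ, if_true]
    have h4 : Real.log 4 = 2 * Real.log 2 := by
      rw [show (4 : ℝ) = 2 ^ 2 by norm_num, Real.log_pow]; norm_num
    rw [Real.log_div hm0.ne' (by norm_num), h4]
    have h5 := mul_le_mul_of_nonneg_right (ha i) (Real.log_nonneg (by linarith : 1 ≤ m))
    linarith
  have hmain : ∑ ω : ∀ i, Ω i, (∏ i, p i (ω i)) * Real.log (∏ i, t i (ω i))
      = ∑ i, ∑ x, p i x * Real.log (t i x) := by
    have h1 : ∀ ω : ∀ i, Ω i, (∏ i, p i (ω i)) * Real.log (∏ i, t i (ω i))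
        = ∑ i, (∏ j, p j (ω j)) * Real.log (t i (ω i)) := by
      intro ω
      rw [Real.log_prod (fun i _ => (ht i _).ne'), Finset.mul_sum]
    simp only [h1]
    rw [Finset.sum_comm]
    exact Finset.sum_congr rfl fun i _ =>
      marginal_aux k Ω p (fun i x => Real.log (t i x)) hp1 i
  have hsum := Finset.sum_le_sum (s := Finset.univ) (fun (ω : ∀ i, Ω i) _ =>
    tangent_aux (∏ i, p i (ω i)) (∏ i, q i (ω i)) (∏ i, t i (ω i))
      (Finset.prod_nonneg fun i _ => hp0 i _) (hqpos ω) (Finset.prod_pos fun i _ => ht i _))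
  rw [Finset.sum_sub_distrib, Finset.sum_add_distrib, hP, hmain] at hsum
  have hk' : ((k : ℝ) / 2) * Real.log (m / 4) ≤ ∑ i, ∑ x, p i x * Real.log (t i x) := by
    have := Finset.sum_le_sum (s := Finset.univ) (fun (i : Fin k) _ => hL i)
    rw [Finset.sum_const, Finset.card_univ, Fintype.card_fin, nsmul_eq_mul] at this
    linarith
  linarith
end

section
/- Let k be a positive integer and m ≥ 2 a real number. Let Ω_1, …, Ω_k be nonempty finite sets, and let p and q be probability distributions on Ω = Ω_1 × ⋯ × Ω_k which are both product distributions, p = p_1 × ⋯ × p_k and q = q_1 × ⋯ × q_k, with p(ω) > 0 and q(ω) > 0 for every ω ∈ Ω. Suppose there exists x* = (x*_1, …, x*_k) ∈ Ω with p({x*}) ≥ 1/2 and q_i({x*_i}) ≤ 1/m for every i ∈ {1,…,k}. Then KL(q‖p) ≥ (k/2)·ln(k/3). -/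
lemma marg_aux {k : ℕ} (Ω : Fin k → Type) [∀ i, Fintype (Ω i)]
    (q f : ∀ i, Ω i → ℝ) (hq1 : ∀ i, ∑ x, q i x = 1) (i : Fin k) :
    ∑ ω : ∀ i, Ω i, (∏ j, q j (ω j)) * f i (ω i) = ∑ x, q i x * f i x := by
  have h := Finset.prod_univ_sum (fun j => (Finset.univ : Finset (Ω j)))
    (fun j x => q j x * (if j = i then f j x else 1))
  rw [Fintype.piFinset_univ] at h
  have h1 : ∀ ω : ∀ i, Ω i, ∏ j, (q j (ω j) * (if j = i then f j (ω j) else 1))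
      = (∏ j, q j (ω j)) * f i (ω i) := by
    intro ω
    rw [Finset.prod_mul_distrib]
    simp
  simp only [h1] at h
  rw [← h, Finset.prod_eq_single i]
  · simp
  · intro j _ hj
    simp [hj, hq1]
  · simp

lemma pos_aux {k : ℕ} (Ω : Fin k → Type) (p : ∀ i, Ω i → ℝ) (xs : ∀ i, Ω i)
    (hp0 : ∀ i x, 0 ≤ p i x) (hppos : ∀ ω : ∀ i, Ω i, 0 < ∏ i, p i (ω i))
    (i : Fin k) (x : Ω i) : 0 < p i x := by
  have h := (Finset.prod_ne_zero_iff.mp (hppos (Function.update xs i x)).ne') i (Finset.mem_univ i)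
  rw [Function.update_self] at h
  exact lt_of_le_of_ne (hp0 i x) (Ne.symm h)

lemma single_aux {X : Type} [Fintype X] (p q : X → ℝ) (hp : ∀ x, 0 < p x) (hq : ∀ x, 0 < q x)
    (hp1 : ∑ x, p x = 1) (hq1 : ∑ x, q x = 1) (s : X) (hps : 1 / 2 ≤ p s) (hqs : q s ≤ 1 / 2)
    (t : ℝ) (ht : 0 < t) :
    1 / 2 * Real.log (1 / (4 * t)) - 1 / 2 * ((1 - p s) / t - 1)
      ≤ ∑ x, q x * Real.log (q x / p x) := by
  classical
  have hpe : ∑ x ∈ Finset.univ.erase s, p x = 1 - p s := by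
    rw [← hp1, ← Finset.add_sum_erase _ p (Finset.mem_univ s)]; ring
  have hqe : ∑ x ∈ Finset.univ.erase s, q x = 1 - q s := by
    rw [← hq1, ← Finset.add_sum_erase _ q (Finset.mem_univ s)]; ring
  have hc : 0 < 1 - p s := by
    rw [← hpe]
    apply Finset.sum_pos (fun x _ => hp x)
    by_contra hne
    rw [Finset.not_nonempty_iff_eq_empty] at hne
    rw [hne] at hqe
    simp at hqe
    linarith
  set a := p s with ha
  set c := 1 - a with hcdef
  have ha0 : 0 < a := hp s
  have key : ∀ r b w : ℝ, 0 < r → 0 < b → 0 < w →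
      b * Real.log (r / w) + b - r ≤ b * Real.log (b / w) := by
    intro r b w hr hb hw
    have h := Real.log_le_sub_one_of_pos (div_pos hr hb)
    rw [Real.log_div hr.ne' hb.ne'] at h
    rw [Real.log_div hr.ne' hw.ne', Real.log_div hb.ne' hw.ne']
    have h2 := mul_le_mul_of_nonneg_left h hb.le
    have h3 : b * (r / b - 1) = r - b := by field_simp
    nlinarith
  have e1 := key (1/2) (q s) a (by norm_num) (hq s) ha0
  have e2 : ∑ x ∈ Finset.univ.erase s, (q x * Real.log (1 / (2 * c)) + q x - p x * (1 / (2 * c)))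
      ≤ ∑ x ∈ Finset.univ.erase s, q x * Real.log (q x / p x) := by
    apply Finset.sum_le_sum
    intro x _
    have := key (p x * (1 / (2 * c))) (q x) (p x) (mul_pos (hp x) (by positivity)) (hq x) (hp x)
    rwa [mul_div_cancel_left₀ _ (hp x).ne'] at this
  rw [Finset.sum_sub_distrib, Finset.sum_add_distrib, ← Finset.sum_mul, ← Finset.sum_mul,
    hpe, hqe] at e2
  have e3 : c * (1 / (2 * c)) = 1 / 2 := by field_simp
  rw [e3] at e2
  rw [← Finset.add_sum_erase _ _ (Finset.mem_univ s)]
  have hla : Real.log a ≤ 0 := Real.log_nonpos ha0.le (by linarith)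
  have hlc : Real.log c ≤ Real.log a := Real.log_le_log hc (by linarith)
  have htl := Real.log_le_sub_one_of_pos (div_pos hc ht)
  rw [Real.log_div hc.ne' ht.ne'] at htl
  have f1 : Real.log (1 / 2 / a) = - Real.log 2 - Real.log a := by
    rw [Real.log_div (by norm_num) ha0.ne', one_div, Real.log_inv]
  have f2 : Real.log (1 / (2 * c)) = - Real.log 2 - Real.log c := by
    rw [one_div, Real.log_inv, Real.log_mul (by norm_num) hc.ne']; ring
  have f3 : Real.log (1 / (4 * t)) = - 2 * Real.log 2 - Real.log t := by
    rw [one_div, Real.log_inv, Real.log_mul (by norm_num) ht.ne',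
      show (4:ℝ) = 2 ^ 2 by norm_num, Real.log_pow]; push_cast; ring
  rw [f1] at e1
  rw [f2] at e2
  rw [f3]
  nlinarith [mul_nonneg (sub_nonneg.2 hqs) (sub_nonneg.2 hlc)]


/-- Let `p = p_1 × ⋯ × p_k` and `q = q_1 × ⋯ × q_k` be product probability
distributions on a product `Ω = Ω_1 × ⋯ × Ω_k` of nonempty finite sets, with
`p` and `q` strictly positive. If there is `x*` with `p({x*}) ≥ 1/2` and
`q_i({x*_i}) ≤ 1/m` for all `i` (where `m ≥ 2`), then
`KL(q‖p) = ∑_ω q(ω) ln(q(ω)/p(ω)) ≥ (k/2)·ln(k/3)`. -/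
theorem kl_product_lower_bound' (k : ℕ) (hk : 0 < k) (m : ℝ) (hm : 2 ≤ m)
    (Ω : Fin k → Type) [∀ i, Fintype (Ω i)] [∀ i, Nonempty (Ω i)]
    (p q : ∀ i, Ω i → ℝ)
    (hp0 : ∀ i x, 0 ≤ p i x) (hp1 : ∀ i, ∑ x, p i x = 1)
    (hq0 : ∀ i x, 0 ≤ q i x) (hq1 : ∀ i, ∑ x, q i x = 1)
    (hppos : ∀ ω : ∀ i, Ω i, 0 < ∏ i, p i (ω i))
    (hqpos : ∀ ω : ∀ i, Ω i, 0 < ∏ i, q i (ω i))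
    (xstar : ∀ i, Ω i)
    (hpx : 1 / 2 ≤ ∏ i, p i (xstar i))
    (hqx : ∀ i, q i (xstar i) ≤ 1 / m) :
    ((k : ℝ) / 2) * Real.log ((k : ℝ) / 3) ≤
      ∑ ω : ∀ i, Ω i,
        (∏ i, q i (ω i)) * Real.log ((∏ i, q i (ω i)) / ∏ i, p i (ω i)) := by
  have hp := pos_aux Ω p xstar hp0 hppos
  have hq := pos_aux Ω q xstar hq0 hqpos
  have hk' : (0 : ℝ) < k := by exact_mod_cast hk
  have hle : ∀ i x, p i x ≤ 1 := by
    intro i x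
    rw [← hp1 i]
    exact Finset.single_le_sum (fun y _ => hp0 i y) (Finset.mem_univ x)
  have hhalf : ∀ i, 1 / 2 ≤ p i (xstar i) := by
    intro i
    refine hpx.trans ?_
    rw [← Finset.mul_prod_erase _ _ (Finset.mem_univ i)]
    exact mul_le_of_le_one_right (hp0 _ _)
      (Finset.prod_le_one (fun j _ => hp0 _ _) (fun j _ => hle _ _))
  have hqh : ∀ i, q i (xstar i) ≤ 1 / 2 := fun i =>
    (hqx i).trans (one_div_le_one_div_of_le (by norm_num) hm)
  have hsum : ∑ i, (1 - p i (xstar i)) ≤ 3 / 4 := by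
    have h1 : ∑ i, (1 - p i (xstar i)) ≤ ∑ i, - Real.log (p i (xstar i)) := by
      apply Finset.sum_le_sum
      intro i _
      have := Real.log_le_sub_one_of_pos (hp i (xstar i))
      linarith
    have h2 := Real.log_le_log (by norm_num) hpx
    rw [Real.log_prod (fun i _ => (hp i _).ne'), one_div, Real.log_inv] at h2
    rw [Finset.sum_neg_distrib] at h1
    have := Real.log_two_lt_d9
    linarith
  have hdec : ∑ ω : ∀ i, Ω i,
        (∏ i, q i (ω i)) * Real.log ((∏ i, q i (ω i)) / ∏ i, p i (ω i))
      = ∑ i, ∑ x, q i x * Real.log (q i x / p i x) := by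
    have h1 : ∀ ω : ∀ i, Ω i,
        (∏ i, q i (ω i)) * Real.log ((∏ i, q i (ω i)) / ∏ i, p i (ω i))
        = ∑ i, (∏ j, q j (ω j)) * Real.log (q i (ω i) / p i (ω i)) := by
      intro ω
      rw [← Finset.prod_div_distrib,
        Real.log_prod (fun i _ => (div_pos (hq i _) (hp i _)).ne'), Finset.mul_sum]
    simp only [h1]
    rw [Finset.sum_comm]
    exact Finset.sum_congr rfl fun i _ =>
      marg_aux Ω q (fun i x => Real.log (q i x / p i x)) hq1 i
  rw [hdec]
  have hfin := Finset.sum_le_sum (s := Finset.univ) fun i _ =>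
    single_aux (p i) (q i) (hp i) (hq i) (hp1 i) (hq1 i) (xstar i) (hhalf i) (hqh i)
      (3 / (4 * k)) (by positivity)
  refine le_trans ?_ hfin
  rw [Finset.sum_sub_distrib, ← Finset.mul_sum, ← Finset.mul_sum, Finset.sum_sub_distrib,
    ← Finset.sum_div]
  have h4 : (1 : ℝ) / (4 * (3 / (4 * k))) = k / 3 := by field_simp
  rw [h4]
  have h5 : (∑ i, (1 - p i (xstar i))) / (3 / (4 * (k : ℝ))) ≤ k := by
    rw [div_le_iff₀ (by positivity)]
    have : (k : ℝ) * (3 / (4 * k)) = 3 / 4 := by field_simp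
    linarith
  simp only [Finset.sum_const, Finset.card_univ, Fintype.card_fin, nsmul_eq_mul, mul_one]
  linarith
end

section
/- Let k be a positive integer and z_1, …, z_k real numbers with 0 ≤ z_i < 1 for all i and ∏_{i=1}^k (1 − z_i) ≥ 1/2. Then ∑_{i=1}^k z_i < ln 2. If moreover z_i > 0 for all i, then ∑_{i=1}^k ln(4·z_i) < k·ln(3/k). -/
/-- Let `z_1, …, z_k ∈ [0,1)` with `∏ (1 − z_i) ≥ 1/2`. Then `∑ z_i < ln 2`,
and if moreover every `z_i > 0`, then `∑ ln(4 z_i) < k · ln(3/k)`. -/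
theorem sum_z_bounds (k : ℕ) (hk : 0 < k) (z : Fin k → ℝ)
    (hz0 : ∀ i, 0 ≤ z i) (hz1 : ∀ i, z i < 1)
    (hprod : 1 / 2 ≤ ∏ i, (1 - z i)) :
    (∑ i, z i < Real.log 2) ∧
    ((∀ i, 0 < z i) →
      ∑ i, Real.log (4 * z i) < (k : ℝ) * Real.log (3 / (k : ℝ))) := by
  have hl2 : 0 < Real.log 2 := Real.log_pos (by norm_num)
  have h1 : ∑ i, z i < Real.log 2 := by
    by_contra! hc
    have hpos : 0 < ∑ i, z i := lt_of_lt_of_le hl2 hc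
    obtain ⟨j, -, hj⟩ := Finset.exists_lt_of_sum_lt (s := Finset.univ)
      (f := fun _ : Fin k => (0 : ℝ)) (g := z) (by simpa using hpos)
    have hlt : ∑ i, Real.log (1 - z i) < ∑ i, (- z i) := by
      apply Finset.sum_lt_sum
      · intro i _
        have := Real.log_le_sub_one_of_pos (sub_pos.2 (hz1 i))
        linarith
      · refine ⟨j, Finset.mem_univ _, ?_⟩
        have := Real.log_lt_sub_one_of_pos (sub_pos.2 (hz1 j)) (by linarith)
        linarith
    rw [← Real.log_prod (fun i _ => (sub_pos.2 (hz1 i)).ne'), Finset.sum_neg_distrib] at hlt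
    have h2 := Real.log_le_log (by norm_num) hprod
    rw [one_div, Real.log_inv] at h2
    linarith
  refine ⟨h1, fun hp => ?_⟩
  have hk' : (0 : ℝ) < k := by exact_mod_cast hk
  have hle : ∑ i, Real.log (4 * z i) ≤
      ∑ i, (4 * k / 3 * z i + (Real.log (3 / (k : ℝ)) - 1)) := by
    apply Finset.sum_le_sum
    intro i _
    have hzi := hp i
    have h3 := Real.log_le_sub_one_of_pos (show 0 < 4 * k / 3 * z i by positivity)
    have h4 : 4 * z i = (4 * k / 3 * z i) * (3 / (k : ℝ)) := by field_simp
    rw [h4, Real.log_mul (by positivity) (by positivity)]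
    linarith
  rw [Finset.sum_add_distrib, ← Finset.mul_sum] at hle
  simp only [Finset.sum_const, Finset.card_univ, Fintype.card_fin, nsmul_eq_mul] at hle
  have h5 : ∑ i, z i < 3 / 4 := by linarith [Real.log_two_lt_d9]
  nlinarith [mul_lt_mul_of_pos_left h5 hk']
end
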